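/- arXiv:2002.10251 — 4 statements merged into one kernel-verified Lean document; each statement's English description precedes it below -/
import Mathlib

section
/- Let f : ℝ → ℝ be twice continuously differentiable, let ε > 0, and let z : ℝ → ℝ be twice continuously differentiable. Then for every t ∈ ℝ, (d/dt)[∂OM/∂v (ż(t), z(t))] − ∂OM/∂x (ż(t), z(t)) = (2/ε²)·[z̈(t) − (ε²/2)·f''(z(t)) − f'(z(t))·f(z(t))]. In particular, z satisfies the Euler–Lagrange equation (d/dt)∂OM/∂v = ∂OM/∂x along (ż(t), z(t)) for all t if and only if z̈(t) = (ε²/2)·f''(z(t)) + f'(z(t))·f(z(t)) for all t. -/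
/-- The Onsager–Machlup function for the scalar SDE `dx = f(x) dt + ε dB_t`:
`OM(v, x) = ((f(x) − v)/ε)² + f'(x)`. -/
noncomputable def OM (f : ℝ → ℝ) (ε : ℝ) (v x : ℝ) : ℝ :=
  ((f x - v) / ε) ^ 2 + deriv f x

theorem hasDerivAt_OM_velocity (f : ℝ → ℝ) (ε v x : ℝ) :
    HasDerivAt (fun v => OM f ε v x) (-(2 / ε ^ 2) * (f x - v)) v := by
  have h := (((((hasDerivAt_id v).const_sub (f x)).div_const ε).pow 2).add_const (deriv f x))
  refine h.congr_deriv ?_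
  simp only [id]
  ring

theorem hasDerivAt_OM_position {f : ℝ → ℝ} {ε v x : ℝ} (hf : DifferentiableAt ℝ f x)
    (hf' : DifferentiableAt ℝ (deriv f) x) :
    HasDerivAt (fun x => OM f ε v x)
      (2 / ε ^ 2 * (f x - v) * deriv f x + deriv (deriv f) x) x := by
  have h := (((hf.hasDerivAt.sub_const v).div_const ε).pow 2).add hf'.hasDerivAt
  refine h.congr_deriv ?_
  ring

/-- For a twice continuously differentiable drift `f`, noise intensity `ε > 0` and a twice
continuously differentiable path `z`, one has, for every `t`,
`(d/dt)[∂OM/∂v (ż(t), z(t))] − ∂OM/∂x (ż(t), z(t))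
  = (2/ε²)·[z̈(t) − (ε²/2)·f''(z(t)) − f'(z(t))·f(z(t))]`;
in particular, `z` satisfies the Euler–Lagrange equation for all `t` iff
`z̈(t) = (ε²/2)·f''(z(t)) + f'(z(t))·f(z(t))` for all `t`. -/
theorem euler_lagrange_identity_scalar
    (f : ℝ → ℝ) (ε : ℝ) (z : ℝ → ℝ)
    (hf : ContDiff ℝ 2 f) (hε : 0 < ε) (hz : ContDiff ℝ 2 z) :
    (∀ t : ℝ,
      deriv (fun s => deriv (fun v => OM f ε v (z s)) (deriv z s)) t
          - deriv (fun x => OM f ε (deriv z t) x) (z t)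
        = (2 / ε ^ 2) *
            (deriv (deriv z) t - (ε ^ 2 / 2) * deriv (deriv f) (z t)
              - deriv f (z t) * f (z t))) ∧
    ((∀ t : ℝ,
        deriv (fun s => deriv (fun v => OM f ε v (z s)) (deriv z s)) t
          = deriv (fun x => OM f ε (deriv z t) x) (z t)) ↔
      (∀ t : ℝ,
        deriv (deriv z) t
          = (ε ^ 2 / 2) * deriv (deriv f) (z t) + deriv f (z t) * f (z t))) := by
  have hf₁ : Differentiable ℝ f := hf.differentiable (by norm_num)
  have hz₁ : Differentiable ℝ z := hz.differentiable (by norm_num)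
  have hf₂ : Differentiable ℝ (deriv f) := hf.differentiable_deriv_two
  have hz₂ : Differentiable ℝ (deriv z) := hz.differentiable_deriv_two
  have hε₀ : ε ≠ 0 := hε.ne'
  have identity : ∀ t : ℝ,
      deriv (fun s => deriv (fun v => OM f ε v (z s)) (deriv z s)) t
          - deriv (fun x => OM f ε (deriv z t) x) (z t)
        = (2 / ε ^ 2) *
            (deriv (deriv z) t - (ε ^ 2 / 2) * deriv (deriv f) (z t)
              - deriv f (z t) * f (z t)) := by
    intro t
    have h_momentum : HasDerivAt (fun s => -(2 / ε ^ 2) * (f (z s) - deriv z s))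
        (-(2 / ε ^ 2) * (deriv f (z t) * deriv z t - deriv (deriv z) t)) t :=
      (((hf₁ (z t)).hasDerivAt.comp t (hz₁ t).hasDerivAt).sub (hz₂ t).hasDerivAt).const_mul _
    simp only [(hasDerivAt_OM_velocity f ε _ _).deriv]
    rw [h_momentum.deriv, (hasDerivAt_OM_position (hf₁ (z t)) (hf₂ (z t))).deriv]
    field_simp
    ring
  refine ⟨identity, forall_congr' fun t => ?_⟩
  rw [← sub_eq_zero, identity t, mul_eq_zero_iff_left (by positivity), sub_sub, sub_eq_zero]
end

section
/- Let f : ℝ → ℝ be twice continuously differentiable, let ε > 0, let T > 0 and x₀, x_T ∈ ℝ. Suppose z : [0,T] → ℝ is twice continuously differentiable with z(0) = x₀ and z(T) = x_T, and z minimizes the OM action ∫₀ᵀ OM(ẇ(t), w(t)) dt over all twice continuously differentiable paths w : [0,T] → ℝ with w(0) = x₀ and w(T) = x_T. Then z satisfies the second-order ordinary differential equation z̈(t) = (ε²/2)·f''(z(t)) + f'(z(t))·f(z(t)) for all t ∈ (0, T). -/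
/-- The Onsager–Machlup action of a path `w` on `[0, T]`:
`∫₀ᵀ OM(ẇ(t), w(t)) dt`. -/
noncomputable def OMaction (f : ℝ → ℝ) (ε T : ℝ) (w : ℝ → ℝ) : ℝ :=
  ∫ t in (0 : ℝ)..T, OM f ε (deriv w t) (w t)

open Set Filter Topology MeasureTheory

/-- Differentiation under the integral sign over a compact interval, for an integrand with a
jointly continuous partial derivative in the parameter. -/
theorem hasDerivAt_intervalIntegral_of_continuous {F F' : ℝ → ℝ → ℝ} (a b s₀ : ℝ)
    (hF : ∀ s, Continuous (F s)) (hF' : Continuous (Function.uncurry F'))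
    (hd : ∀ s t, HasDerivAt (fun s => F s t) (F' s t) s) :
    HasDerivAt (fun s => ∫ t in a..b, F s t) (∫ t in a..b, F' s₀ t) s₀ := by
  obtain ⟨C, hC⟩ := ((isCompact_closedBall s₀ 1).prod
    (isCompact_uIcc (a := a) (b := b))).exists_bound_of_continuousOn hF'.continuousOn
  refine (intervalIntegral.hasDerivAt_integral_of_dominated_loc_of_deriv_le
    (F := F) (F' := F') (bound := fun _ => C)
    (Metric.closedBall_mem_nhds s₀ one_pos)
    (.of_forall fun s => (hF s).aestronglyMeasurable)
    ((hF s₀).intervalIntegrable a b) ?_ ?_ intervalIntegrable_const ?_).2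
  · exact (hF'.comp (Continuous.prodMk_right s₀)).aestronglyMeasurable
  · exact .of_forall fun t ht s hs => hC (s, t) ⟨hs, uIoc_subset_uIcc ht⟩
  · exact .of_forall fun t _ s _ => hd s t

/-- The first variation of the Onsager–Machlup action at `z` in the direction `h`. -/
theorem hasDerivAt_OMaction_add_smul {f z h : ℝ → ℝ} (ε T : ℝ)
    (hf : ContDiff ℝ 2 f) (hz : ContDiff ℝ 2 z) (hh : ContDiff ℝ 2 h) :
    HasDerivAt (fun s : ℝ => OMaction f ε T (fun t => z t + s * h t))
      (∫ t in (0 : ℝ)..T, (2 / ε ^ 2 * (f (z t) - deriv z t) * (deriv f (z t) * h t - deriv h t)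
        + deriv (deriv f) (z t) * h t)) 0 := by
  have hdf : ContDiff ℝ 1 (deriv f) := hf.deriv'
  have hcf := hf.continuous
  have hcdf := hdf.continuous
  have hcddf : Continuous (deriv (deriv f)) := hdf.continuous_deriv le_rfl
  have hcz := hz.continuous
  have hch := hh.continuous
  have hcdz : Continuous (deriv z) := hz.continuous_deriv one_le_two
  have hcdh : Continuous (deriv h) := hh.continuous_deriv one_le_two
  have hderiv (s t : ℝ) : deriv (fun t => z t + s * h t) t = deriv z t + s * deriv h t :=
    ((hz.differentiable two_ne_zero t).hasDerivAt.add
      ((hh.differentiable two_ne_zero t).hasDerivAt.const_mul s)).deriv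
  simp only [OMaction, OM, hderiv]
  have key := hasDerivAt_intervalIntegral_of_continuous
    (F := fun s t => ((f (z t + s * h t) - (deriv z t + s * deriv h t)) / ε) ^ 2
      + deriv f (z t + s * h t))
    (F' := fun s t => 2 / ε ^ 2 * (f (z t + s * h t) - (deriv z t + s * deriv h t))
      * (deriv f (z t + s * h t) * h t - deriv h t) + deriv (deriv f) (z t + s * h t) * h t)
    0 T 0 (fun s => by fun_prop) (by unfold Function.uncurry; fun_prop) fun s t => ?_
  · simpa using key
  · have hpath : HasDerivAt (fun s => z t + s * h t) (h t) s := by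
      simpa using ((hasDerivAt_id s).mul_const (h t)).const_add (z t)
    have hvel : HasDerivAt (fun s => deriv z t + s * deriv h t) (deriv h t) s := by
      simpa using ((hasDerivAt_id s).mul_const (deriv h t)).const_add (deriv z t)
    have hfp := (hf.differentiable two_ne_zero _).hasDerivAt.comp s hpath
    have hdfp := (hdf.differentiable one_ne_zero _).hasDerivAt.comp s hpath
    refine ((((hfp.sub hvel).div_const ε).pow 2).add hdfp).congr_deriv ?_
    simp
    ring

/-- The first variation of the Onsager–Machlup action in a direction vanishing at the endpoints,
after integration by parts. -/
theorem integral_OM_firstVariation_eq {f z h : ℝ → ℝ} (ε T : ℝ)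
    (hf : ContDiff ℝ 2 f) (hz : ContDiff ℝ 2 z) (hh : ContDiff ℝ 2 h)
    (h0 : h 0 = 0) (hT : h T = 0) :
    ∫ t in (0 : ℝ)..T, (2 / ε ^ 2 * (f (z t) - deriv z t) * (deriv f (z t) * h t - deriv h t)
        + deriv (deriv f) (z t) * h t)
      = ∫ t in (0 : ℝ)..T, h t * (2 / ε ^ 2 * (deriv f (z t) * f (z t) - deriv (deriv z) t)
        + deriv (deriv f) (z t)) := by
  have hdf : ContDiff ℝ 1 (deriv f) := hf.deriv'
  have hdz : ContDiff ℝ 1 (deriv z) := hz.deriv'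
  have hcf := hf.continuous
  have hcdf := hdf.continuous
  have hcddf : Continuous (deriv (deriv f)) := hdf.continuous_deriv le_rfl
  have hcz := hz.continuous
  have hch := hh.continuous
  have hcdz := hdz.continuous
  have hcddz : Continuous (deriv (deriv z)) := hdz.continuous_deriv le_rfl
  have hcdh : Continuous (deriv h) := hh.continuous_deriv one_le_two
  rw [← sub_eq_zero, ← intervalIntegral.integral_sub
    (Continuous.intervalIntegrable (by fun_prop) _ _)
    (Continuous.intervalIntegrable (by fun_prop) _ _)]
  rw [intervalIntegral.integral_eq_sub_of_hasDerivAt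
    (f := fun t => -(2 / ε ^ 2) * ((f (z t) - deriv z t) * h t)) (fun t _ => ?_)
    (Continuous.intervalIntegrable (by fun_prop) _ _)]
  · simp [h0, hT]
  · have hfz := (hf.differentiable two_ne_zero _).hasDerivAt.comp t
      (hz.differentiable two_ne_zero t).hasDerivAt
    have hzz := (hdz.differentiable one_ne_zero t).hasDerivAt
    refine (((hfz.sub hzz).mul
      (hh.differentiable two_ne_zero t).hasDerivAt).const_mul (-(2 / ε ^ 2))).congr_deriv ?_
    simp
    ring

/-- If a twice continuously differentiable path `z` with `z(0) = x₀`, `z(T) = x_T` minimizes the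
Onsager–Machlup action over all twice continuously differentiable paths with the same boundary
values, then `z` satisfies the Euler–Lagrange ODE
`z̈(t) = (ε²/2)·f''(z(t)) + f'(z(t))·f(z(t))` on `(0, T)`. -/
theorem most_probable_path_satisfies_euler_lagrange
    (f : ℝ → ℝ) (ε T x₀ xT : ℝ) (z : ℝ → ℝ)
    (hf : ContDiff ℝ 2 f) (hε : 0 < ε) (hT : 0 < T)
    (hz : ContDiff ℝ 2 z) (hz0 : z 0 = x₀) (hzT : z T = xT)
    (hmin : ∀ w : ℝ → ℝ, ContDiff ℝ 2 w → w 0 = x₀ → w T = xT →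
      OMaction f ε T z ≤ OMaction f ε T w) :
    ∀ t ∈ Set.Ioo (0 : ℝ) T,
      deriv (deriv z) t
        = (ε ^ 2 / 2) * deriv (deriv f) (z t) + deriv f (z t) * f (z t) := by
  have hdf : ContDiff ℝ 1 (deriv f) := hf.deriv'
  have hdz : ContDiff ℝ 1 (deriv z) := hz.deriv'
  have hcf := hf.continuous
  have hcdf := hdf.continuous
  have hcddf : Continuous (deriv (deriv f)) := hdf.continuous_deriv le_rfl
  have hcz := hz.continuous
  have hcddz : Continuous (deriv (deriv z)) := hdz.continuous_deriv le_rfl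
  have hG : Continuous fun t => 2 / ε ^ 2 * (deriv f (z t) * f (z t) - deriv (deriv z) t)
      + deriv (deriv f) (z t) := by fun_prop
  have hae := isOpen_Ioo.ae_eq_zero_of_integral_contDiff_smul_eq_zero (U := Ioo 0 T) (μ := volume)
    (hG.locallyIntegrable.locallyIntegrableOn _) fun h hh _ hsupp => by
      have hvanish (t : ℝ) (ht : t ∉ Ioo 0 T) : h t = 0 :=
        image_eq_zero_of_notMem_tsupport fun ht' => ht (hsupp ht')
      have h0 : h 0 = 0 := hvanish 0 (by simp)
      have hT0 : h T = 0 := hvanish T (by simp)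
      have hh2 : ContDiff ℝ 2 h := contDiff_infty.1 hh 2
      have hloc : IsLocalMin (fun s : ℝ => OMaction f ε T (fun t => z t + s * h t)) 0 :=
        .of_forall fun s => by
          simpa using hmin (fun t => z t + s * h t) (hz.add (contDiff_const.mul hh2))
            (by simp [h0, hz0]) (by simp [hT0, hzT])
      have hzero := hloc.hasDerivAt_eq_zero (hasDerivAt_OMaction_add_smul ε T hf hz hh2)
      rw [integral_OM_firstVariation_eq ε T hf hz hh2 h0 hT0,
        intervalIntegral.integral_of_le hT.le, integral_Ioc_eq_integral_Ioo] at hzero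
      rw [← hzero]
      exact (setIntegral_eq_integral_of_forall_compl_eq_zero fun t ht => by
        simp [hvanish t ht]).symm
  intro t ht
  have hEL := Measure.eqOn_open_of_ae_eq ((ae_restrict_iff' measurableSet_Ioo).2 hae) isOpen_Ioo
    hG.continuousOn continuousOn_const ht
  field_simp at hEL
  linarith
end

section
/- The map G restricted to parameters with β₅ > 0 and ε > 0 is injective: if β = (β₀,…,β₉) and β' = (β'₀,…,β'₉) in ℝ¹⁰ satisfy β₅ > 0 and β'₅ > 0, and ε > 0, ε' > 0, and G(β, ε) = G(β', ε'), then β = β' and ε = ε'. -/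
/-- The coefficient map `G : ℝ¹⁰ × ℝ → ℝ³⁸` of the Euler–Lagrange equation of the most probable
transition trajectory, sending the drift coefficients `β = (β₀, …, β₉)` of
`f(x) = β₀ + β₁x + β₂x² + β₃x³ + β₄x⁴ + β₅x⁵ + β₆ sin x + β₇ cos x + β₈ sin 2x + β₉ cos 2x`
and the noise intensity `ε` to the coefficient vector
`b = (b₀, …, b₉, b_{1s}, b_{1c}, …, b_{4s}, b_{4c}, b_{11}, b_{21}, b_{31}, b_{41}, …,
b_{15}, b_{25}, b_{35}, b_{45})`. -/
noncomputable def G (β : Fin 10 → ℝ) (ε : ℝ) : Fin 38 → ℝ :=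
  ![β 0 * β 1 + ε ^ 2 * β 2,
    2 * β 0 * β 2 + β 1 ^ 2 + 3 * ε ^ 2 * β 3,
    3 * β 0 * β 3 + 3 * β 1 * β 2 + 6 * ε ^ 2 * β 4,
    4 * β 0 * β 4 + 4 * β 1 * β 3 + 2 * β 2 ^ 2 + 10 * ε ^ 2 * β 5,
    5 * β 0 * β 5 + 5 * β 1 * β 4 + 5 * β 2 * β 3,
    6 * β 1 * β 5 + 6 * β 2 * β 4 + 3 * β 3 ^ 2,
    7 * β 2 * β 5 + 7 * β 3 * β 4,
    8 * β 3 * β 5 + 4 * β 4 ^ 2,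
    9 * β 4 * β 5,
    5 * β 5 ^ 2,
    -(ε ^ 2) * β 6 / 2 - β 0 * β 7 + β 1 * β 6 - β 6 * β 8 / 2 - β 7 * β 9 / 2,
    -(ε ^ 2) * β 7 / 2 + β 0 * β 6 + β 1 * β 7 + β 7 * β 8 / 2 - β 6 * β 9 / 2,
    -2 * ε ^ 2 * β 8 - 2 * β 0 * β 9 + β 1 * β 8 + β 6 ^ 2 / 2 - β 7 ^ 2 / 2,
    -2 * ε ^ 2 * β 9 + 2 * β 0 * β 8 + β 1 * β 9 + β 6 * β 7,
    3 * (β 6 * β 8 - β 7 * β 9) / 2,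
    3 * (β 7 * β 8 + β 6 * β 9) / 2,
    β 8 ^ 2 - β 9 ^ 2,
    2 * β 8 * β 9,
    2 * β 2 * β 6 - β 1 * β 7,
    2 * β 2 * β 7 + β 1 * β 6,
    2 * β 2 * β 8 - 2 * β 1 * β 9,
    2 * β 2 * β 9 + 2 * β 1 * β 8,
    3 * β 3 * β 6 - β 2 * β 7,
    3 * β 3 * β 7 + β 2 * β 6,
    3 * β 3 * β 8 - 2 * β 2 * β 9,
    3 * β 3 * β 9 + 2 * β 2 * β 8,
    4 * β 4 * β 6 - β 3 * β 7,
    4 * β 4 * β 7 + β 3 * β 6,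
    4 * β 4 * β 8 - 2 * β 3 * β 9,
    4 * β 4 * β 9 + 2 * β 3 * β 8,
    5 * β 5 * β 6 - β 4 * β 7,
    5 * β 5 * β 7 + β 4 * β 6,
    5 * β 5 * β 8 - 2 * β 4 * β 9,
    5 * β 5 * β 9 + 2 * β 4 * β 8,
    -β 5 * β 7,
    β 5 * β 6,
    -2 * β 5 * β 9,
    2 * β 5 * β 8]

/-- The coefficient map `G` is injective on the set of parameters with `β₅ > 0` and `ε > 0`. -/
theorem G_injective_on_beta5_pos
    (β β' : Fin 10 → ℝ) (ε ε' : ℝ)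
    (hβ5 : 0 < β 5) (hβ5' : 0 < β' 5) (hε : 0 < ε) (hε' : 0 < ε')
    (h : G β ε = G β' ε') :
    β = β' ∧ ε = ε' := by
  have comp : ∀ i, G β ε i = G β' ε' i := fun i => congrFun h i
  have h5 : β 5 = β' 5 := by
    have e : 5 * β 5 ^ 2 = 5 * β' 5 ^ 2 := comp 9
    exact (sq_eq_sq₀ hβ5.le hβ5'.le).mp (by linarith)
  have hne : β' 5 ≠ 0 := hβ5'.ne'
  have h4 : β 4 = β' 4 := by
    have e : 9 * β 4 * β 5 = 9 * β' 4 * β' 5 := comp 8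
    rw [h5] at e
    exact mul_right_cancel₀ hne (by linarith)
  have h3 : β 3 = β' 3 := by
    have e : 8 * β 3 * β 5 + 4 * β 4 ^ 2 = 8 * β' 3 * β' 5 + 4 * β' 4 ^ 2 := comp 7
    rw [h5, h4] at e
    exact mul_right_cancel₀ hne (by linarith)
  have h2 : β 2 = β' 2 := by
    have e : 7 * β 2 * β 5 + 7 * β 3 * β 4 = 7 * β' 2 * β' 5 + 7 * β' 3 * β' 4 := comp 6
    rw [h5, h4, h3] at e
    exact mul_right_cancel₀ hne (by linarith)
  have h1 : β 1 = β' 1 := by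
    have e : 6 * β 1 * β 5 + 6 * β 2 * β 4 + 3 * β 3 ^ 2 =
        6 * β' 1 * β' 5 + 6 * β' 2 * β' 4 + 3 * β' 3 ^ 2 := comp 5
    rw [h5, h4, h3, h2] at e
    exact mul_right_cancel₀ hne (by linarith)
  have h0 : β 0 = β' 0 := by
    have e : 5 * β 0 * β 5 + 5 * β 1 * β 4 + 5 * β 2 * β 3 =
        5 * β' 0 * β' 5 + 5 * β' 1 * β' 4 + 5 * β' 2 * β' 3 := comp 4
    rw [h5, h4, h3, h2, h1] at e
    exact mul_right_cancel₀ hne (by linarith)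
  have h7 : β 7 = β' 7 := by
    have e : -β 5 * β 7 = -β' 5 * β' 7 := comp 34
    rw [h5] at e
    exact mul_left_cancel₀ hne (by linarith)
  have h6 : β 6 = β' 6 := by
    have e : β 5 * β 6 = β' 5 * β' 6 := comp 35
    rw [h5] at e
    exact mul_left_cancel₀ hne e
  have h9 : β 9 = β' 9 := by
    have e : -2 * β 5 * β 9 = -2 * β' 5 * β' 9 := comp 36
    rw [h5] at e
    exact mul_left_cancel₀ hne (by linarith)
  have h8 : β 8 = β' 8 := by
    have e : 2 * β 5 * β 8 = 2 * β' 5 * β' 8 := comp 37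
    rw [h5] at e
    exact mul_left_cancel₀ hne (by linarith)
  constructor
  · ext i
    fin_cases i <;> assumption
  · have e : 4 * β 0 * β 4 + 4 * β 1 * β 3 + 2 * β 2 ^ 2 + 10 * ε ^ 2 * β 5 =
        4 * β' 0 * β' 4 + 4 * β' 1 * β' 3 + 2 * β' 2 ^ 2 + 10 * ε' ^ 2 * β' 5 := comp 3
    rw [h5, h4, h3, h2, h1, h0] at e
    exact (sq_eq_sq₀ hε.le hε'.le).mp (mul_right_cancel₀ hne (by linarith))
end

section
/- Let f₁, f₂ : ℝ² → ℝ be twice continuously differentiable, let ε₁, ε₂ > 0, and let z = (z₁, z₂) : ℝ → ℝ² be twice continuously differentiable. Then for every t: (d/dt)[∂OM/∂v₁(ż(t), z(t))] − ∂OM/∂x₁(ż(t), z(t)) = (2/ε₁²)·[z̈₁ − f₁·∂f₁/∂x₁ − (ε₁²/ε₂²)·f₂·∂f₂/∂x₁ − (ε₁²/2)·(∂²f₁/∂x₁² + ∂²f₂/∂x₁∂x₂) − ż₂·(∂f₁/∂x₂ − (ε₁²/ε₂²)·∂f₂/∂x₁)], and (d/dt)[∂OM/∂v₂(ż(t), z(t))]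 − ∂OM/∂x₂(ż(t), z(t)) = (2/ε₂²)·[z̈₂ − f₂·∂f₂/∂x₂ − (ε₂²/ε₁²)·f₁·∂f₁/∂x₂ − (ε₂²/2)·(∂²f₂/∂x₂² + ∂²f₁/∂x₁∂x₂) − ż₁·(∂f₂/∂x₁ − (ε₂²/ε₁²)·∂f₁/∂x₂)], where all partial derivatives of f₁, f₂ are evaluated at z(t). In particular, z satisfies both Euler–Lagrange equations if and only if z̈₁ = f₁·∂f₁/∂x₁ + (ε₁²/ε₂²)·f₂·∂f₂/∂x₁ + (ε₁²/2)·(∂²f₁/∂x₁² + ∂²f₂/∂x₁∂x₂) + ż₂·(∂f₁/∂x₂ − (ε₁²/ε₂²)·∂f₂/∂x₁) and z̈₂ = f₂·∂f₂/∂x₂ + (ε₂²/ε₁²)·f₁·∂f₁/∂x₂ + (ε₂²/2)·(∂²f₂/∂x₂² + ∂²f₁/∂x₁∂x₂) + ż₁·(∂f₂/∂x₁ − (ε₂²/ε₁²)·∂f₁/∂x₂). -/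
/-- Partial derivative with respect to the first variable of a function `ℝ → ℝ → ℝ`. -/
noncomputable def pd1 (f : ℝ → ℝ → ℝ) (a b : ℝ) : ℝ := deriv (fun u => f u b) a

/-- Partial derivative with respect to the second variable of a function `ℝ → ℝ → ℝ`. -/
noncomputable def pd2 (f : ℝ → ℝ → ℝ) (a b : ℝ) : ℝ := deriv (fun u => f a u) b

/-- The Onsager–Machlup function for the two-dimensional SDE system
`dX₁ = f₁(X₁, X₂)dt + ε₁ dB¹, dX₂ = f₂(X₁, X₂)dt + ε₂ dB²`:
`OM(v, x) = ((v₁ − f₁(x))/ε₁)² + ((v₂ − f₂(x))/ε₂)² + ∂f₁/∂x₁(x) + ∂f₂/∂x₂(x)`. -/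
noncomputable def OM2 (f1 f2 : ℝ → ℝ → ℝ) (ε1 ε2 : ℝ) (v1 v2 x1 x2 : ℝ) : ℝ :=
  ((v1 - f1 x1 x2) / ε1) ^ 2 + ((v2 - f2 x1 x2) / ε2) ^ 2
    + pd1 f1 x1 x2 + pd2 f2 x1 x2

lemma hasDerivAt_fst_fderiv {f : ℝ → ℝ → ℝ} {a b : ℝ}
    (hf : DifferentiableAt ℝ (Function.uncurry f) (a, b)) :
    HasDerivAt (fun u => f u b) (fderiv ℝ (Function.uncurry f) (a, b) (1, 0)) a :=
  HasFDerivAt.comp_hasDerivAt (f := fun u => (u, b)) a hf.hasFDerivAt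
    ((hasDerivAt_id' a).prodMk (hasDerivAt_const a b))

lemma hasDerivAt_snd_fderiv {f : ℝ → ℝ → ℝ} {a b : ℝ}
    (hf : DifferentiableAt ℝ (Function.uncurry f) (a, b)) :
    HasDerivAt (fun u => f a u) (fderiv ℝ (Function.uncurry f) (a, b) (0, 1)) b :=
  HasFDerivAt.comp_hasDerivAt (f := fun u => (a, u)) b hf.hasFDerivAt
    ((hasDerivAt_const b a).prodMk (hasDerivAt_id' b))

lemma pd1_eq_fderiv {f : ℝ → ℝ → ℝ} {a b : ℝ}
    (hf : DifferentiableAt ℝ (Function.uncurry f) (a, b)) :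
    pd1 f a b = fderiv ℝ (Function.uncurry f) (a, b) (1, 0) :=
  (hasDerivAt_fst_fderiv hf).deriv

lemma hasDerivAt_pd1 {f : ℝ → ℝ → ℝ} {a b : ℝ}
    (hf : DifferentiableAt ℝ (Function.uncurry f) (a, b)) :
    HasDerivAt (fun u => f u b) (pd1 f a b) a :=
  (hasDerivAt_fst_fderiv hf).differentiableAt.hasDerivAt

lemma pd2_eq_fderiv {f : ℝ → ℝ → ℝ} {a b : ℝ}
    (hf : DifferentiableAt ℝ (Function.uncurry f) (a, b)) :
    pd2 f a b = fderiv ℝ (Function.uncurry f) (a, b) (0, 1) :=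
  (hasDerivAt_snd_fderiv hf).deriv

lemma hasDerivAt_pd2 {f : ℝ → ℝ → ℝ} {a b : ℝ}
    (hf : DifferentiableAt ℝ (Function.uncurry f) (a, b)) :
    HasDerivAt (fun u => f a u) (pd2 f a b) b :=
  (hasDerivAt_snd_fderiv hf).differentiableAt.hasDerivAt

/-- The chain rule for a function of two variables along a path. -/
lemma hasDerivAt_comp_path {f : ℝ → ℝ → ℝ} {x y : ℝ → ℝ} {x' y' t : ℝ}
    (hf : DifferentiableAt ℝ (Function.uncurry f) (x t, y t))
    (hx : HasDerivAt x x' t) (hy : HasDerivAt y y' t) :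
    HasDerivAt (fun s => f (x s) (y s))
      (pd1 f (x t) (y t) * x' + pd2 f (x t) (y t) * y') t := by
  have h := hf.hasFDerivAt.comp_hasDerivAt t (hx.prodMk hy)
  have hdecomp : ((x', y') : ℝ × ℝ) = x' • (1, 0) + y' • (0, 1) := by simp
  rw [hdecomp, map_add, map_smul, map_smul, ← pd1_eq_fderiv hf, ← pd2_eq_fderiv hf] at h
  rw [mul_comm _ x', mul_comm _ y']
  exact h

lemma uncurry_pd1 {f : ℝ → ℝ → ℝ} (hf : Differentiable ℝ (Function.uncurry f)) :
    Function.uncurry (pd1 f) = fun p => fderiv ℝ (Function.uncurry f) p (1, 0) :=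
  funext fun p => pd1_eq_fderiv (hf p)

lemma uncurry_pd2 {f : ℝ → ℝ → ℝ} (hf : Differentiable ℝ (Function.uncurry f)) :
    Function.uncurry (pd2 f) = fun p => fderiv ℝ (Function.uncurry f) p (0, 1) :=
  funext fun p => pd2_eq_fderiv (hf p)

lemma differentiable_fderiv_of_contDiff_two {f : ℝ × ℝ → ℝ} (hf : ContDiff ℝ 2 f) :
    Differentiable ℝ (fderiv ℝ f) :=
  (hf.fderiv_right (m := 1) (by norm_num)).differentiable (by norm_num)

lemma differentiable_pd1 {f : ℝ → ℝ → ℝ} (hf : ContDiff ℝ 2 (Function.uncurry f)) :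
    Differentiable ℝ (Function.uncurry (pd1 f)) := by
  rw [uncurry_pd1 (hf.differentiable (by norm_num))]
  exact (differentiable_fderiv_of_contDiff_two hf).clm_apply (differentiable_const _)

lemma differentiable_pd2 {f : ℝ → ℝ → ℝ} (hf : ContDiff ℝ 2 (Function.uncurry f)) :
    Differentiable ℝ (Function.uncurry (pd2 f)) := by
  rw [uncurry_pd2 (hf.differentiable (by norm_num))]
  exact (differentiable_fderiv_of_contDiff_two hf).clm_apply (differentiable_const _)

/-- Symmetry of the mixed second partial derivatives. -/
lemma pd2_pd1_eq_pd1_pd2 {f : ℝ → ℝ → ℝ} (hf : ContDiff ℝ 2 (Function.uncurry f)) (a b : ℝ) :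
    pd2 (pd1 f) a b = pd1 (pd2 f) a b := by
  have hd := hf.differentiable (by norm_num)
  have hdd := differentiable_fderiv_of_contDiff_two hf
  have hsymm : IsSymmSndFDerivAt ℝ (Function.uncurry f) (a, b) :=
    hf.contDiffAt.isSymmSndFDerivAt (by simp)
  rw [pd2_eq_fderiv (differentiable_pd1 hf _), pd1_eq_fderiv (differentiable_pd2 hf _),
    uncurry_pd1 hd, uncurry_pd2 hd, fderiv_clm_apply (hdd _) (differentiableAt_const _),
    fderiv_clm_apply (hdd _) (differentiableAt_const _)]
  simpa using hsymm.eq (0, 1) (1, 0)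

/-- Derivative of an Onsager–Machlup type expression `((v₁ - g₁)/ε₁)² + ((v₂ - g₂)/ε₂)² + g₃ + g₄`
along one variable. -/
lemma hasDerivAt_onsagerMachlup {v1 v2 g1 g2 g3 g4 : ℝ → ℝ}
    {v1' v2' g1' g2' g3' g4' x : ℝ} (ε1 ε2 : ℝ)
    (hv1 : HasDerivAt v1 v1' x) (hv2 : HasDerivAt v2 v2' x)
    (hg1 : HasDerivAt g1 g1' x) (hg2 : HasDerivAt g2 g2' x)
    (hg3 : HasDerivAt g3 g3' x) (hg4 : HasDerivAt g4 g4' x) :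
    HasDerivAt
      (fun u => ((v1 u - g1 u) / ε1) ^ 2 + ((v2 u - g2 u) / ε2) ^ 2 + g3 u + g4 u)
      (2 / ε1 ^ 2 * ((v1 x - g1 x) * (v1' - g1')) + 2 / ε2 ^ 2 * ((v2 x - g2 x) * (v2' - g2'))
        + g3' + g4') x := by
  refine HasDerivAt.congr_deriv ((((((hv1.sub hg1).div_const ε1).pow 2).add
    (((hv2.sub hg2).div_const ε2).pow 2)).add hg3).add hg4) ?_
  simp only [Pi.sub_apply, Nat.cast_ofNat]
  ring

lemma deriv_OM2_v1 (f1 f2 : ℝ → ℝ → ℝ) (ε1 ε2 v1 v2 x1 x2 : ℝ) :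
    deriv (fun v => OM2 f1 f2 ε1 ε2 v v2 x1 x2) v1 = 2 / ε1 ^ 2 * (v1 - f1 x1 x2) := by
  refine (hasDerivAt_onsagerMachlup ε1 ε2 (hasDerivAt_id v1) (hasDerivAt_const v1 v2)
    (hasDerivAt_const v1 (f1 x1 x2)) (hasDerivAt_const v1 (f2 x1 x2))
    (hasDerivAt_const v1 (pd1 f1 x1 x2)) (hasDerivAt_const v1 (pd2 f2 x1 x2))).deriv.trans ?_
  simp

lemma deriv_OM2_v2 (f1 f2 : ℝ → ℝ → ℝ) (ε1 ε2 v1 v2 x1 x2 : ℝ) :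
    deriv (fun v => OM2 f1 f2 ε1 ε2 v1 v x1 x2) v2 = 2 / ε2 ^ 2 * (v2 - f2 x1 x2) := by
  refine (hasDerivAt_onsagerMachlup ε1 ε2 (hasDerivAt_const v2 v1) (hasDerivAt_id v2)
    (hasDerivAt_const v2 (f1 x1 x2)) (hasDerivAt_const v2 (f2 x1 x2))
    (hasDerivAt_const v2 (pd1 f1 x1 x2)) (hasDerivAt_const v2 (pd2 f2 x1 x2))).deriv.trans ?_
  simp

lemma deriv_OM2_x1 {f1 f2 : ℝ → ℝ → ℝ} (hf1 : ContDiff ℝ 2 (Function.uncurry f1))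
    (hf2 : ContDiff ℝ 2 (Function.uncurry f2)) (ε1 ε2 v1 v2 x1 x2 : ℝ) :
    deriv (fun u => OM2 f1 f2 ε1 ε2 v1 v2 u x2) x1 =
      2 / ε1 ^ 2 * ((v1 - f1 x1 x2) * (0 - pd1 f1 x1 x2))
        + 2 / ε2 ^ 2 * ((v2 - f2 x1 x2) * (0 - pd1 f2 x1 x2))
        + pd1 (pd1 f1) x1 x2 + pd1 (pd2 f2) x1 x2 :=
  (hasDerivAt_onsagerMachlup ε1 ε2 (hasDerivAt_const x1 v1) (hasDerivAt_const x1 v2)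
    (hasDerivAt_pd1 (hf1.differentiable (by norm_num) _))
    (hasDerivAt_pd1 (hf2.differentiable (by norm_num) _))
    (hasDerivAt_pd1 (differentiable_pd1 hf1 _))
    (hasDerivAt_pd1 (differentiable_pd2 hf2 _))).deriv

lemma deriv_OM2_x2 {f1 f2 : ℝ → ℝ → ℝ} (hf1 : ContDiff ℝ 2 (Function.uncurry f1))
    (hf2 : ContDiff ℝ 2 (Function.uncurry f2)) (ε1 ε2 v1 v2 x1 x2 : ℝ) :
    deriv (fun u => OM2 f1 f2 ε1 ε2 v1 v2 x1 u) x2 =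
      2 / ε1 ^ 2 * ((v1 - f1 x1 x2) * (0 - pd2 f1 x1 x2))
        + 2 / ε2 ^ 2 * ((v2 - f2 x1 x2) * (0 - pd2 f2 x1 x2))
        + pd2 (pd1 f1) x1 x2 + pd2 (pd2 f2) x1 x2 :=
  (hasDerivAt_onsagerMachlup ε1 ε2 (hasDerivAt_const x2 v1) (hasDerivAt_const x2 v2)
    (hasDerivAt_pd2 (hf1.differentiable (by norm_num) _))
    (hasDerivAt_pd2 (hf2.differentiable (by norm_num) _))
    (hasDerivAt_pd2 (differentiable_pd1 hf1 _))
    (hasDerivAt_pd2 (differentiable_pd2 hf2 _))).deriv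

lemma differentiable_deriv_of_contDiff_two {z : ℝ → ℝ} (hz : ContDiff ℝ 2 z) :
    Differentiable ℝ (deriv z) :=
  (hz.iterate_deriv' 1 1).differentiable (by norm_num)

/-- Time derivative of the momentum `2 (w - f(z)) / ε²` along a path. -/
lemma deriv_momentum {f : ℝ → ℝ → ℝ} {w x y : ℝ → ℝ} {t : ℝ} (ε : ℝ)
    (hf : DifferentiableAt ℝ (Function.uncurry f) (x t, y t)) (hw : DifferentiableAt ℝ w t)
    (hx : DifferentiableAt ℝ x t) (hy : DifferentiableAt ℝ y t) :
    deriv (fun s => 2 / ε ^ 2 * (w s - f (x s) (y s))) t =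
      2 / ε ^ 2 * (deriv w t
        - (pd1 f (x t) (y t) * deriv x t + pd2 f (x t) (y t) * deriv y t)) :=
  ((hw.hasDerivAt.sub
    (hasDerivAt_comp_path hf hx.hasDerivAt hy.hasDerivAt)).const_mul (2 / ε ^ 2)).deriv

/-- For twice continuously differentiable `f₁, f₂ : ℝ² → ℝ`, `ε₁, ε₂ > 0` and a twice
continuously differentiable path `z = (z₁, z₂)`, the two Euler–Lagrange expressions of the
two-dimensional Onsager–Machlup functional satisfy the stated identities; in particular, `z`
satisfies both Euler–Lagrange equations iff it satisfies the corresponding second-order ODE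
system. -/
theorem euler_lagrange_identity_two_dim
    (f1 f2 : ℝ → ℝ → ℝ) (ε1 ε2 : ℝ) (z1 z2 : ℝ → ℝ)
    (hf1 : ContDiff ℝ 2 (Function.uncurry f1)) (hf2 : ContDiff ℝ 2 (Function.uncurry f2))
    (hε1 : 0 < ε1) (hε2 : 0 < ε2)
    (hz1 : ContDiff ℝ 2 z1) (hz2 : ContDiff ℝ 2 z2) :
    (∀ t : ℝ,
      deriv (fun s =>
          deriv (fun v1 => OM2 f1 f2 ε1 ε2 v1 (deriv z2 s) (z1 s) (z2 s)) (deriv z1 s)) t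
        - deriv (fun u => OM2 f1 f2 ε1 ε2 (deriv z1 t) (deriv z2 t) u (z2 t)) (z1 t)
      = (2 / ε1 ^ 2) *
          (deriv (deriv z1) t
            - f1 (z1 t) (z2 t) * pd1 f1 (z1 t) (z2 t)
            - (ε1 ^ 2 / ε2 ^ 2) * f2 (z1 t) (z2 t) * pd1 f2 (z1 t) (z2 t)
            - (ε1 ^ 2 / 2) * (pd1 (pd1 f1) (z1 t) (z2 t) + pd1 (pd2 f2) (z1 t) (z2 t))
            - deriv z2 t *
                (pd2 f1 (z1 t) (z2 t) - (ε1 ^ 2 / ε2 ^ 2) * pd1 f2 (z1 t) (z2 t)))) ∧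
    (∀ t : ℝ,
      deriv (fun s =>
          deriv (fun v2 => OM2 f1 f2 ε1 ε2 (deriv z1 s) v2 (z1 s) (z2 s)) (deriv z2 s)) t
        - deriv (fun u => OM2 f1 f2 ε1 ε2 (deriv z1 t) (deriv z2 t) (z1 t) u) (z2 t)
      = (2 / ε2 ^ 2) *
          (deriv (deriv z2) t
            - f2 (z1 t) (z2 t) * pd2 f2 (z1 t) (z2 t)
            - (ε2 ^ 2 / ε1 ^ 2) * f1 (z1 t) (z2 t) * pd2 f1 (z1 t) (z2 t)
            - (ε2 ^ 2 / 2) * (pd2 (pd2 f2) (z1 t) (z2 t) + pd1 (pd2 f1) (z1 t) (z2 t))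
            - deriv z1 t *
                (pd1 f2 (z1 t) (z2 t) - (ε2 ^ 2 / ε1 ^ 2) * pd2 f1 (z1 t) (z2 t)))) ∧
    (((∀ t : ℝ,
        deriv (fun s =>
            deriv (fun v1 => OM2 f1 f2 ε1 ε2 v1 (deriv z2 s) (z1 s) (z2 s)) (deriv z1 s)) t
          = deriv (fun u => OM2 f1 f2 ε1 ε2 (deriv z1 t) (deriv z2 t) u (z2 t)) (z1 t)) ∧
      (∀ t : ℝ,
        deriv (fun s =>
            deriv (fun v2 => OM2 f1 f2 ε1 ε2 (deriv z1 s) v2 (z1 s) (z2 s)) (deriv z2 s)) t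
          = deriv (fun u => OM2 f1 f2 ε1 ε2 (deriv z1 t) (deriv z2 t) (z1 t) u) (z2 t))) ↔
      ((∀ t : ℝ,
        deriv (deriv z1) t
          = f1 (z1 t) (z2 t) * pd1 f1 (z1 t) (z2 t)
            + (ε1 ^ 2 / ε2 ^ 2) * f2 (z1 t) (z2 t) * pd1 f2 (z1 t) (z2 t)
            + (ε1 ^ 2 / 2) * (pd1 (pd1 f1) (z1 t) (z2 t) + pd1 (pd2 f2) (z1 t) (z2 t))
            + deriv z2 t *
                (pd2 f1 (z1 t) (z2 t) - (ε1 ^ 2 / ε2 ^ 2) * pd1 f2 (z1 t) (z2 t))) ∧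
      (∀ t : ℝ,
        deriv (deriv z2) t
          = f2 (z1 t) (z2 t) * pd2 f2 (z1 t) (z2 t)
            + (ε2 ^ 2 / ε1 ^ 2) * f1 (z1 t) (z2 t) * pd2 f1 (z1 t) (z2 t)
            + (ε2 ^ 2 / 2) * (pd2 (pd2 f2) (z1 t) (z2 t) + pd1 (pd2 f1) (z1 t) (z2 t))
            + deriv z1 t *
                (pd1 f2 (z1 t) (z2 t) - (ε2 ^ 2 / ε1 ^ 2) * pd2 f1 (z1 t) (z2 t))))) := by
  have hε1' : ε1 ≠ 0 := hε1.ne'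
  have hε2' : ε2 ≠ 0 := hε2.ne'
  have hc1 : 2 / ε1 ^ 2 ≠ 0 := by positivity
  have hc2 : 2 / ε2 ^ 2 ≠ 0 := by positivity
  have hz1d := hz1.differentiable (by norm_num)
  have hz2d := hz2.differentiable (by norm_num)
  refine and_assoc.mp ((and_iff_left_of_imp ?_).mpr ⟨fun t => ?_, fun t => ?_⟩)
  · rintro ⟨h1, h2⟩
    refine and_congr (forall_congr' fun t => ?_) (forall_congr' fun t => ?_)
    · rw [← sub_eq_zero, h1 t, mul_eq_zero, or_iff_right hc1]
      constructor <;> intro h <;> linear_combination h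
    · rw [← sub_eq_zero, h2 t, mul_eq_zero, or_iff_right hc2]
      constructor <;> intro h <;> linear_combination h
  · simp only [deriv_OM2_v1]
    rw [deriv_momentum ε1 (hf1.differentiable (by norm_num) _)
      (differentiable_deriv_of_contDiff_two hz1 t) (hz1d t) (hz2d t), deriv_OM2_x1 hf1 hf2]
    field_simp
    ring
  · simp only [deriv_OM2_v2]
    rw [deriv_momentum ε2 (hf2.differentiable (by norm_num) _)
      (differentiable_deriv_of_contDiff_two hz2 t) (hz1d t) (hz2d t), deriv_OM2_x2 hf1 hf2,
      pd2_pd1_eq_pd1_pd2 hf1]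
    field_simp
    ring
end
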